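/- There is a universal constant K > 0 such that for all N ≥ 1, all β ∈ (0,1], and all t ∈ [0,1], 0 ≤ E⟨R⁻(σ¹,τ¹)·R⁻(σ²,τ¹)·R⁻(σ¹,σ²)⟩_{t,0} ≤ K·(E⟨R(σ,τ)²⟩_t)^{1/2}·(E⟨R(σ¹,σ²)⁴⟩)^{1/2}, where ⟨·⟩ is the Gibbs average of the original single SK system at inverse temperature β. -/

import Mathlib

open MeasureTheory ProbabilityTheory Real Finset Filter

noncomputable section

/-- Spin configurations: each of the `N` sites carries a `±1` spin, encoded by a `Bool`. -/
abbrev Config (N : ℕ) := Fin N → Bool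

/-- The `±1` value of a spin. -/
def spin (b : Bool) : ℝ := if b then 1 else -1

/-- The value of the last spin `σ_N` (junk value `0` when `N = 0`). -/
def spinLast {N : ℕ} (σ : Config N) : ℝ :=
  if h : 0 < N then spin (σ ⟨N - 1, Nat.sub_lt h Nat.one_pos⟩) else 0

/-- The Gaussian disorder: i.i.d. standard Gaussians indexed by pairs `(i, j)`
(only the entries with `i < j` are used). -/
def gaussPi (N : ℕ) : Measure (Fin N × Fin N → ℝ) :=
  Measure.pi fun _ => gaussianReal 0 1

instance (N : ℕ) : IsProbabilityMeasure (gaussPi N) := by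
  unfold gaussPi; infer_instance

/-- Three independent copies `g, g', g''` of the disorder. -/
def disM3 (N : ℕ) :
    Measure ((Fin N × Fin N → ℝ) × (Fin N × Fin N → ℝ) × (Fin N × Fin N → ℝ)) :=
  (gaussPi N).prod ((gaussPi N).prod (gaussPi N))

/-- The SK Hamiltonian `H_{N,β}(σ) = (β/√N) ∑_{i<j} g_{ij} σ_i σ_j`. -/
def ham (N : ℕ) (β : ℝ) (g : Fin N × Fin N → ℝ) (σ : Config N) : ℝ :=
  (β / Real.sqrt N) *
    ∑ p ∈ Finset.univ.filter (fun p : Fin N × Fin N => p.1 < p.2),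
      g p * spin (σ p.1) * spin (σ p.2)

/-- The cavity Hamiltonian `H⁻_N(σ) = (β/√N) ∑_{i<j<N} g_{ij} σ_i σ_j` on the first
`N - 1` spins. -/
def hamCav (N : ℕ) (β : ℝ) (g : Fin N × Fin N → ℝ) (σ : Config N) : ℝ :=
  (β / Real.sqrt N) *
    ∑ p ∈ Finset.univ.filter
        (fun p : Fin N × Fin N => p.1 < p.2 ∧ (p.2 : ℕ) < N - 1),
      g p * spin (σ p.1) * spin (σ p.2)

/-- The overlap `R(σ¹,σ²) = (1/N) ∑_{i ≤ N} σ_i¹ σ_i²`. -/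
def ovlp (N : ℕ) (σ τ : Config N) : ℝ := (∑ i, spin (σ i) * spin (τ i)) / N

/-- The truncated overlap `R⁻(σ¹,σ²) = (1/N) ∑_{i ≤ N−1} σ_i¹ σ_i²`. -/
def ovlpm (N : ℕ) (σ τ : Config N) : ℝ :=
  (∑ i ∈ Finset.univ.filter (fun i : Fin N => (i : ℕ) < N - 1),
    spin (σ i) * spin (τ i)) / N

/-- The partition function `Z_N(β)`. -/
def partFun (N : ℕ) (β : ℝ) (g : Fin N × Fin N → ℝ) : ℝ :=
  ∑ σ : Config N, Real.exp (ham N β g σ)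

/-- The free energy `F_N(β) = ln Z_N(β)`. -/
def freeEnergy (N : ℕ) (β : ℝ) (g : Fin N × Fin N → ℝ) : ℝ :=
  Real.log (partFun N β g)

/-- Two-replica Gibbs average `⟨f⟩` for the single SK system. -/
def gibbs2 (N : ℕ) (β : ℝ) (g : Fin N × Fin N → ℝ)
    (f : Config N → Config N → ℝ) : ℝ :=
  (∑ σ : Config N, ∑ τ : Config N,
    f σ τ * Real.exp (ham N β g σ + ham N β g τ)) / (partFun N β g) ^ 2

/-- Disorder expectation of the two-replica Gibbs average. -/
def Egibbs2 (N : ℕ) (β : ℝ) (f : Config N → Config N → ℝ) : ℝ :=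
  ∫ g, gibbs2 N β g f ∂gaussPi N

/-- The interpolated Hamiltonian `√t · H_N + √(1−t) · H'_N`. -/
def hamT (N : ℕ) (β t : ℝ) (g g' : Fin N × Fin N → ℝ) (σ : Config N) : ℝ :=
  Real.sqrt t * ham N β g σ + Real.sqrt (1 - t) * ham N β g' σ

/-- The coupled Gibbs weight `exp(H¹_{N,t}(σ) + H²_{N,t}(τ))`. -/
def wT (N : ℕ) (β t : ℝ) (g g' g'' : Fin N × Fin N → ℝ)
    (ρ : Config N × Config N) : ℝ :=
  Real.exp (hamT N β t g g' ρ.1 + hamT N β t g g'' ρ.2)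

/-- The coupled Gibbs average `⟨f⟩_t` of a function of one pair `(σ, τ)`. -/
def gibbsT (N : ℕ) (β t : ℝ) (g g' g'' : Fin N × Fin N → ℝ)
    (f : Config N × Config N → ℝ) : ℝ :=
  (∑ ρ : Config N × Config N, f ρ * wT N β t g g' g'' ρ) /
    (∑ ρ : Config N × Config N, wT N β t g g' g'' ρ)

/-- The coupled Gibbs average `⟨f⟩_t` of a function of two pairs. -/
def gibbsT2 (N : ℕ) (β t : ℝ) (g g' g'' : Fin N × Fin N → ℝ)
    (f : Config N × Config N → Config N × Config N → ℝ) : ℝ :=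
  (∑ ρ₁ : Config N × Config N, ∑ ρ₂ : Config N × Config N,
    f ρ₁ ρ₂ * wT N β t g g' g'' ρ₁ * wT N β t g g' g'' ρ₂) /
    (∑ ρ : Config N × Config N, wT N β t g g' g'' ρ) ^ 2

/-- Disorder expectation `E⟨f⟩_t` (one pair). -/
def EgibbsT (N : ℕ) (β t : ℝ) (f : Config N × Config N → ℝ) : ℝ :=
  ∫ ω, gibbsT N β t ω.1 ω.2.1 ω.2.2 f ∂disM3 N

/-- Disorder expectation `E⟨f⟩_t` (two pairs). -/
def EgibbsT2 (N : ℕ) (β t : ℝ)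
    (f : Config N × Config N → Config N × Config N → ℝ) : ℝ :=
  ∫ ω, gibbsT2 N β t ω.1 ω.2.1 ω.2.2 f ∂disM3 N

/-- The `s`-dependent cavity field term
`(β/√N) σ_N ∑_{i<N} (√t g_{iN} + √(1−t) g'_{iN}) σ_i`. -/
def cavField (N : ℕ) (β t : ℝ) (g g' : Fin N × Fin N → ℝ) (σ : Config N) : ℝ :=
  if h : 0 < N then
    (β / Real.sqrt N) * spin (σ ⟨N - 1, Nat.sub_lt h Nat.one_pos⟩) *
      ∑ i ∈ Finset.univ.filter (fun i : Fin N => (i : ℕ) < N - 1),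
        (Real.sqrt t * g (i, ⟨N - 1, Nat.sub_lt h Nat.one_pos⟩) +
          Real.sqrt (1 - t) * g' (i, ⟨N - 1, Nat.sub_lt h Nat.one_pos⟩)) * spin (σ i)
  else 0

/-- The cavity-interpolated Hamiltonian `H^1_{N,t,s}` (resp. `H^2_{N,t,s}` with `g''`). -/
def hamTS (N : ℕ) (β t s : ℝ) (g g' : Fin N × Fin N → ℝ) (σ : Config N) : ℝ :=
  Real.sqrt t * hamCav N β g σ + Real.sqrt (1 - t) * hamCav N β g' σ +
    Real.sqrt s * cavField N β t g g' σ

/-- The coupled cavity Gibbs weight `exp(H¹_{N,t,s}(σ) + H²_{N,t,s}(τ))`. -/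
def wTS (N : ℕ) (β t s : ℝ) (g g' g'' : Fin N × Fin N → ℝ)
    (ρ : Config N × Config N) : ℝ :=
  Real.exp (hamTS N β t s g g' ρ.1 + hamTS N β t s g g'' ρ.2)

/-- The coupled cavity Gibbs average `⟨f⟩_{t,s}` of a function of one pair. -/
def gibbsTS1 (N : ℕ) (β t s : ℝ) (g g' g'' : Fin N × Fin N → ℝ)
    (f : Config N × Config N → ℝ) : ℝ :=
  (∑ ρ : Config N × Config N, f ρ * wTS N β t s g g' g'' ρ) /
    (∑ ρ : Config N × Config N, wTS N β t s g g' g'' ρ)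

/-- The coupled cavity Gibbs average `⟨f⟩_{t,s}` of a function of two pairs. -/
def gibbsTS2 (N : ℕ) (β t s : ℝ) (g g' g'' : Fin N × Fin N → ℝ)
    (f : Config N × Config N → Config N × Config N → ℝ) : ℝ :=
  (∑ ρ₁ : Config N × Config N, ∑ ρ₂ : Config N × Config N,
    f ρ₁ ρ₂ * wTS N β t s g g' g'' ρ₁ * wTS N β t s g g' g'' ρ₂) /
    (∑ ρ : Config N × Config N, wTS N β t s g g' g'' ρ) ^ 2

/-- The coupled cavity Gibbs average `⟨f⟩_{t,s}` of a function of `n` pairs. -/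
def gibbsTSn (N : ℕ) (β t s : ℝ) (g g' g'' : Fin N × Fin N → ℝ) {n : ℕ}
    (f : (Fin n → Config N × Config N) → ℝ) : ℝ :=
  (∑ ρ : Fin n → Config N × Config N, f ρ * ∏ l, wTS N β t s g g' g'' (ρ l)) /
    (∑ ρ₀ : Config N × Config N, wTS N β t s g g' g'' ρ₀) ^ n

/-- Disorder expectation `E⟨f⟩_{t,s}` (one pair). -/
def EgibbsTS1 (N : ℕ) (β t s : ℝ) (f : Config N × Config N → ℝ) : ℝ :=
  ∫ ω, gibbsTS1 N β t s ω.1 ω.2.1 ω.2.2 f ∂disM3 N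

/-- Disorder expectation `E⟨f⟩_{t,s}` (two pairs). -/
def EgibbsTS2 (N : ℕ) (β t s : ℝ)
    (f : Config N × Config N → Config N × Config N → ℝ) : ℝ :=
  ∫ ω, gibbsTS2 N β t s ω.1 ω.2.1 ω.2.2 f ∂disM3 N

/-- Disorder expectation `E⟨f⟩_{t,s}` (`n` pairs). -/
def EgibbsTSn (N : ℕ) (β t s : ℝ) {n : ℕ}
    (f : (Fin n → Config N × Config N) → ℝ) : ℝ :=
  ∫ ω, gibbsTSn N β t s ω.1 ω.2.1 ω.2.2 f ∂disM3 N

/-- The covariance kernel `U(ρ, ρ')` of the `s`-part of the coupled cavity Hamiltonians. -/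
def Ufun (N : ℕ) (β t : ℝ) (ρ ρ' : Config N × Config N) : ℝ :=
  β ^ 2 / 2 * (spinLast ρ.1 * spinLast ρ'.1 * ovlpm N ρ.1 ρ'.1 +
      spinLast ρ.2 * spinLast ρ'.2 * ovlpm N ρ.2 ρ'.2) +
    β ^ 2 * t / 2 * (spinLast ρ.1 * spinLast ρ'.2 * ovlpm N ρ.1 ρ'.2 +
      spinLast ρ.2 * spinLast ρ'.1 * ovlpm N ρ.2 ρ'.1)

/-- `ν(β) = −(1/2)·ln(1 − β²) − β²/2`. -/
def nuSK (b : ℝ) : ℝ := -(1 / 2) * Real.log (1 - b ^ 2) - b ^ 2 / 2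

section MeasureTransport

lemma measurePreserving_prodProdProdComm {α β γ δ : Type*} [MeasurableSpace α]
    [MeasurableSpace β] [MeasurableSpace γ] [MeasurableSpace δ] (μ : Measure α) (ν : Measure β)
    (κ : Measure γ) (η : Measure δ) [SFinite μ] [SFinite ν] [SFinite κ] [SFinite η] :
    MeasurePreserving (fun x : (α × β) × (γ × δ) => ((x.1.1, x.2.1), (x.1.2, x.2.2)))
      ((μ.prod ν).prod (κ.prod η)) ((μ.prod κ).prod (ν.prod η)) := by
  have swap : MeasurePreserving (fun x : β × (γ × δ) => (x.2.1, (x.1, x.2.2)))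
      (ν.prod (κ.prod η)) (κ.prod (ν.prod η)) :=
    (measurePreserving_prodAssoc κ ν η).comp
      ((Measure.measurePreserving_swap.prod (MeasurePreserving.id η)).comp
        (measurePreserving_prodAssoc ν κ η).symm)
  exact (measurePreserving_prodAssoc μ κ (ν.prod η)).symm.comp
    (((MeasurePreserving.id μ).prod swap).comp (measurePreserving_prodAssoc μ ν (κ.prod η)))

lemma MeasurePreserving.prod_of_prod {α β : Type*} [MeasurableSpace α] [MeasurableSpace β]
    {μ : Measure α} {ν : Measure β} [SFinite μ] [SFinite ν] {φ : α × α → α} {ψ : β × β → β}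
    (hφ : MeasurePreserving φ (μ.prod μ) μ) (hψ : MeasurePreserving ψ (ν.prod ν) ν) :
    MeasurePreserving (fun x : (α × β) × (α × β) => (φ (x.1.1, x.2.1), ψ (x.1.2, x.2.2)))
      ((μ.prod ν).prod (μ.prod ν)) (μ.prod ν) :=
  (hφ.prod hψ).comp (measurePreserving_prodProdProdComm μ ν μ ν)

lemma measurePreserving_pi_combine {ι E : Type*} [Fintype ι] [MeasurableSpace E]
    (ν : Measure E) [IsProbabilityMeasure ν] (φ : ι → E × E → E)
    (hφ : ∀ i, MeasurePreserving (φ i) (ν.prod ν) ν) :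
    MeasurePreserving (fun (x : (ι → E) × (ι → E)) i => φ i (x.1 i, x.2 i))
      ((Measure.pi fun _ : ι => ν).prod (Measure.pi fun _ : ι => ν))
      (Measure.pi fun _ : ι => ν) := by
  have combine : MeasurePreserving (fun (x : ι → E × E) i => φ i (x i))
      (Measure.pi fun _ : ι => ν.prod ν) (Measure.pi fun _ : ι => ν) :=
    measurePreserving_pi _ _ hφ
  exact combine.comp
    (measurePreserving_arrowProdEquivProdArrow E E ι (fun _ => ν) (fun _ => ν)).symm

lemma integral_comp_measurePreserving {α β : Type*} [MeasurableSpace α] [MeasurableSpace β]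
    {μ : Measure α} {ν : Measure β} {φ : α → β} (hφ : MeasurePreserving φ μ ν) {f : β → ℝ}
    (hf : Measurable f) : ∫ x, f (φ x) ∂μ = ∫ y, f y ∂ν := by
  rw [← hφ.map_eq, integral_map hφ.aemeasurable hf.aestronglyMeasurable]

/-- `√t·a + √(1−t)·b` is standard Gaussian when `a, b` are independent standard Gaussians. -/
lemma measurePreserving_gaussianReal_rotate {t : ℝ} (ht : t ∈ Set.Icc (0 : ℝ) 1) :
    MeasurePreserving (fun x : ℝ × ℝ => √t * x.1 + √(1 - t) * x.2)
      ((gaussianReal 0 1).prod (gaussianReal 0 1)) (gaussianReal 0 1) := by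
  refine ⟨by fun_prop, ?_⟩
  have hind : IndepFun (fun x : ℝ × ℝ => √t * x.1) (fun x : ℝ × ℝ => √(1 - t) * x.2)
      ((gaussianReal 0 1).prod (gaussianReal 0 1)) :=
    indepFun_prod (μ := gaussianReal 0 1) (ν := gaussianReal 0 1)
      (X := fun x : ℝ => √t * x) (Y := fun x : ℝ => √(1 - t) * x) (by fun_prop) (by fun_prop)
  have hfst : ((gaussianReal 0 1).prod (gaussianReal 0 1)).map (fun x : ℝ × ℝ => √t * x.1) =
      gaussianReal (√t * 0) (NNReal.mk (√t ^ 2) (sq_nonneg _) * 1) := by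
    rw [← gaussianReal_map_const_mul]
    conv_rhs => rw [← measurePreserving_fst (μ := gaussianReal 0 1) (ν := gaussianReal 0 1)
      |>.map_eq]
    rw [Measure.map_map (by fun_prop) (by fun_prop)]
    rfl
  have hsnd : ((gaussianReal 0 1).prod (gaussianReal 0 1)).map
      (fun x : ℝ × ℝ => √(1 - t) * x.2) =
      gaussianReal (√(1 - t) * 0) (NNReal.mk (√(1 - t) ^ 2) (sq_nonneg _) * 1) := by
    rw [← gaussianReal_map_const_mul]
    conv_rhs => rw [← measurePreserving_snd (μ := gaussianReal 0 1) (ν := gaussianReal 0 1)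
      |>.map_eq]
    rw [Measure.map_map (by fun_prop) (by fun_prop)]
    rfl
  have hsum := gaussianReal_add_gaussianReal_of_indepFun hind hfst hsnd
  refine hsum.trans ?_
  congr 1
  · simp
  · ext
    simp [Real.sq_sqrt ht.1, Real.sq_sqrt (sub_nonneg.2 ht.2)]

end MeasureTransport

/-- A disorder realisation `(g, g', g'')`. -/
abbrev Disorder (N : ℕ) :=
  (Fin N × Fin N → ℝ) × (Fin N × Fin N → ℝ) × (Fin N × Fin N → ℝ)

instance (N : ℕ) : IsProbabilityMeasure (disM3 N) := by
  unfold disM3; infer_instance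

/-- The couplings `√t·g + √(1−t)·g'` seen by the first system. -/
def couplingFst {N : ℕ} (t : ℝ) (ω : Disorder N) : Fin N × Fin N → ℝ :=
  fun p => √t * ω.1 p + √(1 - t) * ω.2.1 p

/-- The couplings `√t·g + √(1−t)·g''` seen by the second system. -/
def couplingSnd {N : ℕ} (t : ℝ) (ω : Disorder N) : Fin N × Fin N → ℝ :=
  fun p => √t * ω.1 p + √(1 - t) * ω.2.2 p

/-- The Gibbs probability of `σ` for the cavity-interpolated Hamiltonian with couplings `J`. -/
def gibbsProb (N : ℕ) (β s : ℝ) (J : Fin N × Fin N → ℝ) (σ : Config N) : ℝ :=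
  Real.exp (hamTS N β 1 s J 0 σ) / ∑ σ' : Config N, Real.exp (hamTS N β 1 s J 0 σ')

section GibbsProb

variable {N : ℕ} {β s t : ℝ}

lemma gibbsProb_nonneg (J : Fin N × Fin N → ℝ) (σ : Config N) : 0 ≤ gibbsProb N β s J σ := by
  unfold gibbsProb; positivity

lemma sum_gibbsProb (J : Fin N × Fin N → ℝ) : ∑ σ, gibbsProb N β s J σ = 1 := by
  unfold gibbsProb
  rw [← Finset.sum_div]
  exact div_self (by positivity)

lemma gibbsProb_le_one (J : Fin N × Fin N → ℝ) (σ : Config N) : gibbsProb N β s J σ ≤ 1 := by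
  rw [← sum_gibbsProb (β := β) (s := s) J]
  exact Finset.single_le_sum (fun σ' _ => gibbsProb_nonneg J σ') (Finset.mem_univ σ)

lemma measurable_cavField (σ : Config N) :
    Measurable fun J : Fin N × Fin N → ℝ => cavField N β 1 J 0 σ := by
  unfold cavField
  split_ifs <;> fun_prop

lemma measurable_hamTS (σ : Config N) :
    Measurable fun J : Fin N × Fin N → ℝ => hamTS N β 1 s J 0 σ := by
  have := measurable_cavField (β := β) σ
  unfold hamTS hamCav
  fun_prop

@[fun_prop]
lemma measurable_gibbsProb (σ : Config N) :
    Measurable fun J : Fin N × Fin N → ℝ => gibbsProb N β s J σ := by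
  have := measurable_hamTS (N := N) (β := β) (s := s)
  unfold gibbsProb
  fun_prop

lemma hamTS_eq_coupling (g g' : Fin N × Fin N → ℝ) (σ : Config N) :
    hamTS N β t s g g' σ = hamTS N β 1 s (fun p => √t * g p + √(1 - t) * g' p) 0 σ := by
  have hcav : hamCav N β (fun p => √t * g p + √(1 - t) * g' p) σ =
      √t * hamCav N β g σ + √(1 - t) * hamCav N β g' σ := by
    simp only [hamCav, Finset.mul_sum, ← Finset.sum_add_distrib]
    exact Finset.sum_congr rfl fun p _ => by ring
  have hfield : cavField N β 1 (fun p => √t * g p + √(1 - t) * g' p) 0 σ =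
      cavField N β t g g' σ := by
    simp [cavField]
  simp [hamTS, hcav, hfield]

lemma measurePreserving_couplingFst (ht : t ∈ Set.Icc (0 : ℝ) 1) :
    MeasurePreserving (couplingFst (N := N) t) (disM3 N) (gaussPi N) :=
  (measurePreserving_pi_combine (ι := Fin N × Fin N) (gaussianReal 0 1)
    (fun _ x => √t * x.1 + √(1 - t) * x.2)
    fun _ => measurePreserving_gaussianReal_rotate ht).comp
    ((MeasurePreserving.id (gaussPi N)).prod measurePreserving_fst)

lemma measurePreserving_couplingSnd (ht : t ∈ Set.Icc (0 : ℝ) 1) :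
    MeasurePreserving (couplingSnd (N := N) t) (disM3 N) (gaussPi N) :=
  (measurePreserving_pi_combine (ι := Fin N × Fin N) (gaussianReal 0 1)
    (fun _ x => √t * x.1 + √(1 - t) * x.2)
    fun _ => measurePreserving_gaussianReal_rotate ht).comp
    ((MeasurePreserving.id (gaussPi N)).prod measurePreserving_snd)

/-- The probability of the pair `ρ` under the coupled product Gibbs measure. -/
def pairProb (N : ℕ) (β t s : ℝ) (ω : Disorder N) (ρ : Config N × Config N) : ℝ :=
  gibbsProb N β s (couplingFst t ω) ρ.1 * gibbsProb N β s (couplingSnd t ω) ρ.2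

lemma pairProb_nonneg (ω : Disorder N) (ρ : Config N × Config N) :
    0 ≤ pairProb N β t s ω ρ :=
  mul_nonneg (gibbsProb_nonneg _ _) (gibbsProb_nonneg _ _)

lemma pairProb_le_one (ω : Disorder N) (ρ : Config N × Config N) :
    pairProb N β t s ω ρ ≤ 1 :=
  mul_le_one₀ (gibbsProb_le_one _ _) (gibbsProb_nonneg _ _) (gibbsProb_le_one _ _)

lemma sum_pairProb (ω : Disorder N) : ∑ ρ, pairProb N β t s ω ρ = 1 := by
  simp [pairProb, Fintype.sum_prod_type, ← Finset.mul_sum, sum_gibbsProb]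

@[fun_prop]
lemma measurable_pairProb (ρ : Config N × Config N) :
    Measurable fun ω : Disorder N => pairProb N β t s ω ρ := by
  unfold pairProb couplingFst couplingSnd
  exact ((measurable_gibbsProb ρ.1).comp (by fun_prop)).mul
    ((measurable_gibbsProb ρ.2).comp (by fun_prop))

lemma Integrable.of_measurable_of_abs_le {Ω : Type*} [MeasurableSpace Ω] {μ : Measure Ω}
    [IsFiniteMeasure μ] {f : Ω → ℝ} (hf : Measurable f) {C : ℝ} (hC : ∀ x, |f x| ≤ C) :
    Integrable f μ :=
  Integrable.of_bound hf.aestronglyMeasurable C (ae_of_all _ hC)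

lemma integrable_pairProb (ρ : Config N × Config N) :
    Integrable (fun ω => pairProb N β t s ω ρ) (disM3 N) :=
  Integrable.of_measurable_of_abs_le (measurable_pairProb ρ) (C := 1) fun ω => by
    rw [abs_of_nonneg (pairProb_nonneg ω ρ)]; exact pairProb_le_one ω ρ

lemma integrable_pairProb_mul_pairProb (ρ₁ ρ₂ : Config N × Config N) :
    Integrable (fun ω => pairProb N β t s ω ρ₁ * pairProb N β t s ω ρ₂) (disM3 N) :=
  Integrable.of_measurable_of_abs_le (by fun_prop) (C := 1) fun ω => by
    rw [abs_of_nonneg (mul_nonneg (pairProb_nonneg ω ρ₁) (pairProb_nonneg ω ρ₂))]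
    exact mul_le_one₀ (pairProb_le_one ω ρ₁) (pairProb_nonneg ω ρ₂) (pairProb_le_one ω ρ₂)

lemma wTS_div_sum (ω : Disorder N) (ρ : Config N × Config N) :
    wTS N β t s ω.1 ω.2.1 ω.2.2 ρ / ∑ ρ', wTS N β t s ω.1 ω.2.1 ω.2.2 ρ' =
      pairProb N β t s ω ρ := by
  have hw : ∀ ρ : Config N × Config N, wTS N β t s ω.1 ω.2.1 ω.2.2 ρ =
      Real.exp (hamTS N β 1 s (couplingFst t ω) 0 ρ.1) *
        Real.exp (hamTS N β 1 s (couplingSnd t ω) 0 ρ.2) := fun ρ => by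
    rw [wTS, Real.exp_add, hamTS_eq_coupling, hamTS_eq_coupling (g' := ω.2.2)]
    rfl
  simp_rw [hw, Fintype.sum_prod_type, ← Finset.mul_sum, ← Finset.sum_mul]
  rw [mul_div_mul_comm]
  rfl

lemma gibbsTS1_eq_sum (ω : Disorder N) (f : Config N × Config N → ℝ) :
    gibbsTS1 N β t s ω.1 ω.2.1 ω.2.2 f = ∑ ρ, f ρ * pairProb N β t s ω ρ := by
  simp_rw [gibbsTS1, Finset.sum_div, mul_div_assoc, wTS_div_sum]

lemma gibbsTS2_eq_sum (ω : Disorder N)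
    (f : Config N × Config N → Config N × Config N → ℝ) :
    gibbsTS2 N β t s ω.1 ω.2.1 ω.2.2 f =
      ∑ ρ₁, ∑ ρ₂, f ρ₁ ρ₂ * (pairProb N β t s ω ρ₁ * pairProb N β t s ω ρ₂) := by
  simp_rw [gibbsTS2, Finset.sum_div]
  refine Finset.sum_congr rfl fun ρ₁ _ => Finset.sum_congr rfl fun ρ₂ _ => ?_
  rw [← wTS_div_sum, ← wTS_div_sum]
  ring

lemma EgibbsTS1_eq_sum (f : Config N × Config N → ℝ) :
    EgibbsTS1 N β t s f = ∑ ρ, f ρ * ∫ ω, pairProb N β t s ω ρ ∂disM3 N := by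
  simp_rw [EgibbsTS1, gibbsTS1_eq_sum]
  rw [integral_finsetSum _ fun ρ _ => (integrable_pairProb ρ).const_mul _]
  simp_rw [integral_const_mul]

lemma EgibbsTS2_eq_sum (f : Config N × Config N → Config N × Config N → ℝ) :
    EgibbsTS2 N β t s f = ∑ ρ₁, ∑ ρ₂, f ρ₁ ρ₂ *
      ∫ ω, pairProb N β t s ω ρ₁ * pairProb N β t s ω ρ₂ ∂disM3 N := by
  simp_rw [EgibbsTS2, gibbsTS2_eq_sum]
  rw [integral_finsetSum _ fun ρ₁ _ => integrable_finsetSum _ fun ρ₂ _ =>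
    (integrable_pairProb_mul_pairProb ρ₁ ρ₂).const_mul _]
  refine Finset.sum_congr rfl fun ρ₁ _ => ?_
  rw [integral_finsetSum _ fun ρ₂ _ => (integrable_pairProb_mul_pairProb ρ₁ ρ₂).const_mul _]
  simp_rw [integral_const_mul]

end GibbsProb

/-- The Gibbs average of a function of a single configuration. -/
def gibbsAvg (N : ℕ) (β s : ℝ) (J : Fin N × Fin N → ℝ) (u : Config N → ℝ) : ℝ :=
  ∑ σ, u σ * gibbsProb N β s J σ

section Replicas

variable {N : ℕ} {β s t : ℝ}

@[fun_prop]
lemma measurable_gibbsAvg (u : Config N → ℝ) :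
    Measurable fun J => gibbsAvg N β s J u := by
  unfold gibbsAvg; fun_prop

lemma abs_gibbsAvg_le (J : Fin N × Fin N → ℝ) (u : Config N → ℝ) :
    |gibbsAvg N β s J u| ≤ ∑ σ, |u σ| := by
  refine (Finset.abs_sum_le_sum_abs _ _).trans (Finset.sum_le_sum fun σ _ => ?_)
  rw [abs_mul, abs_of_nonneg (gibbsProb_nonneg J σ)]
  exact mul_le_of_le_one_right (abs_nonneg _) (gibbsProb_le_one J σ)

lemma integrable_gibbsAvg_mul {Ω : Type*} [MeasurableSpace Ω] {μ : Measure Ω}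
    [IsFiniteMeasure μ] {X Y : Ω → Fin N × Fin N → ℝ} (hX : Measurable X) (hY : Measurable Y)
    (u : Config N → ℝ) :
    Integrable (fun ω => gibbsAvg N β s (X ω) u * gibbsAvg N β s (Y ω) u) μ :=
  Integrable.of_measurable_of_abs_le (C := (∑ σ, |u σ|) * ∑ σ, |u σ|)
    (((measurable_gibbsAvg u).comp hX).mul ((measurable_gibbsAvg u).comp hY)) fun ω => by
      rw [abs_mul]
      exact mul_le_mul (abs_gibbsAvg_le _ u) (abs_gibbsAvg_le _ u) (abs_nonneg _)
        ((abs_nonneg _).trans (abs_gibbsAvg_le (β := β) (s := s) (X ω) u))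

lemma EgibbsTS1_mul_eq_integral (u : Config N → ℝ) :
    EgibbsTS1 N β t s (fun ρ => u ρ.1 * u ρ.2) =
      ∫ ω, gibbsAvg N β s (couplingFst t ω) u * gibbsAvg N β s (couplingSnd t ω) u
        ∂disM3 N := by
  simp_rw [EgibbsTS1, gibbsTS1_eq_sum, gibbsAvg, pairProb, Fintype.sum_prod_type,
    Finset.sum_mul_sum]
  congr with ω
  exact Finset.sum_congr rfl fun σ _ => Finset.sum_congr rfl fun τ _ => by ring

lemma measurable_couplingFst : Measurable (couplingFst (N := N) t) := by
  unfold couplingFst; fun_prop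

lemma measurable_couplingSnd : Measurable (couplingSnd (N := N) t) := by
  unfold couplingSnd; fun_prop

/-- Given the shared disorder `g`, the two systems are independent and identically distributed. -/
lemma EgibbsTS1_mul_nonneg (u : Config N → ℝ) :
    0 ≤ EgibbsTS1 N β t s (fun ρ => u ρ.1 * u ρ.2) := by
  rw [EgibbsTS1_mul_eq_integral, disM3, integral_prod]
  · refine integral_nonneg fun g => ?_
    change 0 ≤ ∫ x : (Fin N × Fin N → ℝ) × (Fin N × Fin N → ℝ),
      gibbsAvg N β s (fun p => √t * g p + √(1 - t) * x.1 p) u *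
        gibbsAvg N β s (fun p => √t * g p + √(1 - t) * x.2 p) u ∂_
    rw [integral_prod_mul (μ := gaussPi N) (ν := gaussPi N)
      (fun y => gibbsAvg N β s (fun p => √t * g p + √(1 - t) * y p) u)
      (fun y => gibbsAvg N β s (fun p => √t * g p + √(1 - t) * y p) u)]
    exact mul_self_nonneg _
  · exact integrable_gibbsAvg_mul measurable_couplingFst measurable_couplingSnd u

lemma couplingFst_one (ω : Disorder N) : couplingFst 1 ω = ω.1 := by
  ext p; simp [couplingFst]

lemma couplingSnd_one (ω : Disorder N) : couplingSnd 1 ω = ω.1 := by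
  ext p; simp [couplingSnd]

lemma EgibbsTS1_one_eq_integral (f : Config N × Config N → ℝ) :
    EgibbsTS1 N β 1 s f = ∫ g, ∑ ρ : Config N × Config N,
      f ρ * (gibbsProb N β s g ρ.1 * gibbsProb N β s g ρ.2) ∂gaussPi N := by
  rw [← integral_comp_measurePreserving (measurePreserving_fst (μ := gaussPi N)
    (ν := (gaussPi N).prod (gaussPi N))) (by fun_prop)]
  simp [EgibbsTS1, gibbsTS1_eq_sum, pairProb, couplingFst_one, couplingSnd_one, disM3]

lemma integral_gibbsAvg_sq (u : Config N → ℝ) :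
    ∫ J, gibbsAvg N β s J u ^ 2 ∂gaussPi N = EgibbsTS1 N β 1 s (fun ρ => u ρ.1 * u ρ.2) := by
  simp_rw [EgibbsTS1_one_eq_integral, gibbsAvg, sq, Fintype.sum_prod_type, Finset.sum_mul_sum]
  congr with ω
  exact Finset.sum_congr rfl fun σ _ => Finset.sum_congr rfl fun τ _ => by ring

lemma EgibbsTS1_mul_le_one (ht : t ∈ Set.Icc (0 : ℝ) 1) (u : Config N → ℝ) :
    EgibbsTS1 N β t s (fun ρ => u ρ.1 * u ρ.2) ≤
      EgibbsTS1 N β 1 s (fun ρ => u ρ.1 * u ρ.2) := by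
  have hmeas : Measurable fun J => gibbsAvg N β s J u ^ 2 := by fun_prop
  have hfst := integral_comp_measurePreserving (measurePreserving_couplingFst ht) hmeas
  have hsnd := integral_comp_measurePreserving (measurePreserving_couplingSnd ht) hmeas
  have int_fst : Integrable (fun ω => gibbsAvg N β s (couplingFst t ω) u ^ 2) (disM3 N) := by
    simpa only [sq] using integrable_gibbsAvg_mul measurable_couplingFst measurable_couplingFst u
  have int_snd : Integrable (fun ω => gibbsAvg N β s (couplingSnd t ω) u ^ 2) (disM3 N) := by
    simpa only [sq] using integrable_gibbsAvg_mul measurable_couplingSnd measurable_couplingSnd u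
  rw [EgibbsTS1_mul_eq_integral]
  calc _ ≤ ∫ ω, (gibbsAvg N β s (couplingFst t ω) u ^ 2 +
        gibbsAvg N β s (couplingSnd t ω) u ^ 2) / 2 ∂disM3 N := by
        refine integral_mono (integrable_gibbsAvg_mul measurable_couplingFst
          measurable_couplingSnd u) ((int_fst.add int_snd).div_const 2) fun ω => ?_
        dsimp only
        nlinarith [sq_nonneg (gibbsAvg N β s (couplingFst t ω) u -
          gibbsAvg N β s (couplingSnd t ω) u)]
    _ = _ := by
        rw [integral_div, integral_add int_fst int_snd, hfst, hsnd, integral_gibbsAvg_sq]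
        ring

lemma EgibbsTS1_sum {κ : Type*} (A : Finset κ) (F : κ → Config N × Config N → ℝ) :
    EgibbsTS1 N β t s (fun ρ => ∑ a ∈ A, F a ρ) = ∑ a ∈ A, EgibbsTS1 N β t s (F a) := by
  simp_rw [EgibbsTS1_eq_sum, Finset.sum_mul]
  exact Finset.sum_comm

/-- Products of spins, indexed by the sites appearing in a power of the overlap. -/
def spinProd {k : ℕ} (x : Fin k → Fin N) (σ : Config N) : ℝ := ∏ l, spin (σ (x l))

lemma sum_spin_mul_div_pow (S : Finset (Fin N)) (k : ℕ) (σ τ : Config N) :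
    ((∑ i ∈ S, spin (σ i) * spin (τ i)) / N) ^ k =
      ∑ x ∈ Fintype.piFinset fun _ : Fin k => S,
        ((√(N : ℝ))⁻¹ ^ k * spinProd x σ) * ((√(N : ℝ))⁻¹ ^ k * spinProd x τ) := by
  have hN : (√(N : ℝ))⁻¹ ^ k * (√(N : ℝ))⁻¹ ^ k = ((N : ℝ) ^ k)⁻¹ := by
    rw [← mul_pow, ← mul_inv, Real.mul_self_sqrt (Nat.cast_nonneg N), inv_pow]
  rw [div_pow, Finset.sum_pow', Finset.sum_div]
  refine Finset.sum_congr rfl fun x _ => ?_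
  rw [mul_mul_mul_comm, hN, spinProd, spinProd, ← Finset.prod_mul_distrib]
  ring

lemma EgibbsTS1_ovlpm_pow_le_ovlp_pow (k : ℕ) :
    EgibbsTS1 N β t s (fun ρ => ovlpm N ρ.1 ρ.2 ^ k) ≤
      EgibbsTS1 N β t s (fun ρ => ovlp N ρ.1 ρ.2 ^ k) := by
  simp_rw [ovlpm, ovlp, sum_spin_mul_div_pow, EgibbsTS1_sum]
  refine Finset.sum_le_sum_of_subset_of_nonneg ?_ fun x _ _ =>
    EgibbsTS1_mul_nonneg fun σ => (√(N : ℝ))⁻¹ ^ k * spinProd x σ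
  exact Fintype.piFinset_subset _ _ fun _ => Finset.filter_subset _ _

lemma EgibbsTS1_ovlpm_pow_le_one (ht : t ∈ Set.Icc (0 : ℝ) 1) (k : ℕ) :
    EgibbsTS1 N β t s (fun ρ => ovlpm N ρ.1 ρ.2 ^ k) ≤
      EgibbsTS1 N β 1 s (fun ρ => ovlpm N ρ.1 ρ.2 ^ k) := by
  simp_rw [ovlpm, sum_spin_mul_div_pow, EgibbsTS1_sum]
  exact Finset.sum_le_sum fun x _ =>
    EgibbsTS1_mul_le_one ht fun σ => (√(N : ℝ))⁻¹ ^ k * spinProd x σ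

end Replicas

section CavityComparison

variable {N : ℕ} {β t : ℝ}

/-- Flip the last spin. -/
def flipLast {n : ℕ} (σ : Config (n + 1)) : Config (n + 1) :=
  Function.update σ (Fin.last n) (!σ (Fin.last n))

lemma flipLast_involutive {n : ℕ} : Function.Involutive (flipLast (n := n)) := fun σ => by
  simp [flipLast]

lemma flipLast_of_lt {n : ℕ} (σ : Config (n + 1)) {i : Fin (n + 1)} (hi : (i : ℕ) < n) :
    flipLast σ i = σ i :=
  Function.update_of_ne (Fin.ne_of_lt hi) _ _

lemma spin_not (b : Bool) : spin (!b) = -spin b := by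
  cases b <;> simp [spin]

lemma spin_mul_self (b : Bool) : spin b * spin b = 1 := by
  cases b <;> simp [spin]

lemma hamCav_flipLast {n : ℕ} (J : Fin (n + 1) × Fin (n + 1) → ℝ) (σ : Config (n + 1)) :
    hamCav (n + 1) β J (flipLast σ) = hamCav (n + 1) β J σ := by
  unfold hamCav
  congr 1
  refine Finset.sum_congr rfl fun p hp => ?_
  obtain ⟨hlt, hlast⟩ := (Finset.mem_filter.1 hp).2
  rw [flipLast_of_lt σ hlast, flipLast_of_lt σ (lt_trans hlt hlast)]

lemma cavField_eq {n : ℕ} (J : Fin (n + 1) × Fin (n + 1) → ℝ) (σ : Config (n + 1)) :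
    cavField (n + 1) β 1 J 0 σ = (β / √((n + 1 : ℕ) : ℝ)) * spin (σ (Fin.last n)) *
      ∑ i ∈ Finset.univ.filter (fun i : Fin (n + 1) => (i : ℕ) < n),
        J (i, Fin.last n) * spin (σ i) := by
  simp [cavField, Fin.last]

lemma cavField_flipLast {n : ℕ} (J : Fin (n + 1) × Fin (n + 1) → ℝ) (σ : Config (n + 1)) :
    cavField (n + 1) β 1 J 0 (flipLast σ) = -cavField (n + 1) β 1 J 0 σ := by
  have hsum : ∑ i ∈ Finset.univ.filter (fun i : Fin (n + 1) => (i : ℕ) < n),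
      J (i, Fin.last n) * spin (flipLast σ i) =
      ∑ i ∈ Finset.univ.filter (fun i : Fin (n + 1) => (i : ℕ) < n),
        J (i, Fin.last n) * spin (σ i) :=
    Finset.sum_congr rfl fun i hi => by rw [flipLast_of_lt σ (Finset.mem_filter.1 hi).2]
  rw [cavField_eq, cavField_eq, hsum, flipLast, Function.update_self, spin_not]
  ring

lemma ovlpm_flipLast {n : ℕ} (σ τ : Config (n + 1)) :
    ovlpm (n + 1) (flipLast σ) (flipLast τ) = ovlpm (n + 1) σ τ := by
  unfold ovlpm
  congr 1
  refine Finset.sum_congr rfl fun i hi => ?_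
  have hlt : (i : ℕ) < n := (Finset.mem_filter.1 hi).2
  rw [flipLast_of_lt σ hlt, flipLast_of_lt τ hlt]

lemma hamTS_zero (J : Fin N × Fin N → ℝ) (σ : Config N) :
    hamTS N β 1 0 J 0 σ = hamCav N β J σ := by
  simp [hamTS]

lemma hamTS_one (J : Fin N × Fin N → ℝ) (σ : Config N) :
    hamTS N β 1 1 J 0 σ = hamCav N β J σ + cavField N β 1 J 0 σ := by
  simp [hamTS]

lemma gibbsProb_flipLast {n : ℕ} (J : Fin (n + 1) × Fin (n + 1) → ℝ) (σ : Config (n + 1)) :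
    gibbsProb (n + 1) β 0 J (flipLast σ) = gibbsProb (n + 1) β 0 J σ := by
  simp_rw [gibbsProb, hamTS_zero, hamCav_flipLast]

lemma gibbsProb_one_mul_sum (J : Fin N × Fin N → ℝ) (σ : Config N) :
    gibbsProb N β 1 J σ *
        ∑ σ', gibbsProb N β 0 J σ' * Real.exp (cavField N β 1 J 0 σ') =
      gibbsProb N β 0 J σ * Real.exp (cavField N β 1 J 0 σ) := by
  simp_rw [gibbsProb, hamTS_zero, hamTS_one, Real.exp_add, div_mul_eq_mul_div]
  rw [← Finset.sum_div]
  have h0 : 0 < ∑ σ' : Config N, Real.exp (hamCav N β J σ') := by positivity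
  have h1 : 0 < ∑ σ' : Config N,
    Real.exp (hamCav N β J σ') * Real.exp (cavField N β 1 J 0 σ') := by positivity
  field_simp

lemma sum_le_sum_mul_exp_of_odd {κ : Type*} [Fintype κ] {e : κ → κ}
    (he : Function.Involutive e) {u c : κ → ℝ} (hu : ∀ x, 0 ≤ u x) (hue : ∀ x, u (e x) = u x)
    (hce : ∀ x, c (e x) = -c x) : ∑ x, u x ≤ ∑ x, u x * Real.exp (c x) := by
  have hflip : ∑ x, u x * Real.exp (c x) = ∑ x, u x * Real.exp (-c x) := by
    rw [← Equiv.sum_comp he.toPerm]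
    simp [hue, hce]
  have hcosh : ∑ x, u x * 2 ≤ ∑ x, u x * Real.exp (c x) + ∑ x, u x * Real.exp (-c x) := by
    rw [← Finset.sum_add_distrib]
    refine Finset.sum_le_sum fun x _ => ?_
    rw [← mul_add]
    refine mul_le_mul_of_nonneg_left ?_ (hu x)
    linarith [Real.one_le_cosh (c x), Real.cosh_eq (c x)]
  rw [← hflip, ← Finset.sum_mul] at hcosh
  linarith

/-- The cavity field acting on a pair of configurations. -/
def pairField (N : ℕ) (β t : ℝ) (ω : Disorder N) (ρ : Config N × Config N) : ℝ :=
  cavField N β 1 (couplingFst t ω) 0 ρ.1 + cavField N β 1 (couplingSnd t ω) 0 ρ.2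

@[fun_prop]
lemma measurable_pairField (ρ : Config N × Config N) :
    Measurable fun ω : Disorder N => pairField N β t ω ρ :=
  ((measurable_cavField ρ.1).comp measurable_couplingFst).add
    ((measurable_cavField ρ.2).comp measurable_couplingSnd)

lemma pairProb_one_mul_sum (ω : Disorder N) (ρ : Config N × Config N) :
    pairProb N β t 1 ω ρ *
        ∑ ρ', pairProb N β t 0 ω ρ' * Real.exp (pairField N β t ω ρ') =
      pairProb N β t 0 ω ρ * Real.exp (pairField N β t ω ρ) := by
  have hsum : ∑ ρ', pairProb N β t 0 ω ρ' * Real.exp (pairField N β t ω ρ') =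
      (∑ σ, gibbsProb N β 0 (couplingFst t ω) σ *
          Real.exp (cavField N β 1 (couplingFst t ω) 0 σ)) *
        ∑ τ, gibbsProb N β 0 (couplingSnd t ω) τ *
          Real.exp (cavField N β 1 (couplingSnd t ω) 0 τ) := by
    simp_rw [pairProb, pairField, Real.exp_add, Fintype.sum_prod_type, Finset.sum_mul_sum]
    exact Finset.sum_congr rfl fun σ _ => Finset.sum_congr rfl fun τ _ => by ring
  rw [hsum, pairProb, mul_mul_mul_comm, gibbsProb_one_mul_sum, gibbsProb_one_mul_sum, pairProb,
    pairField, Real.exp_add]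
  ring

lemma sum_pairProb_zero_le {n : ℕ} (ω : Disorder (n + 1))
    {f : Config (n + 1) × Config (n + 1) → ℝ} (hf : ∀ ρ, 0 ≤ f ρ)
    (hflip : ∀ σ τ, f (flipLast σ, flipLast τ) = f (σ, τ)) :
    ∑ ρ, f ρ * pairProb (n + 1) β t 0 ω ρ ≤
      (∑ ρ, f ρ * pairProb (n + 1) β t 1 ω ρ) *
        ∑ ρ, pairProb (n + 1) β t 0 ω ρ * Real.exp (pairField (n + 1) β t ω ρ) := by
  rw [Finset.sum_mul]
  simp_rw [mul_assoc, pairProb_one_mul_sum, ← mul_assoc]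
  refine sum_le_sum_mul_exp_of_odd (e := Prod.map flipLast flipLast)
    (flipLast_involutive.prodMap flipLast_involutive)
    (fun ρ => mul_nonneg (hf ρ) (pairProb_nonneg ω ρ)) (fun ρ => ?_) (fun ρ => ?_)
  · simp only [Prod.map, hflip, pairProb, gibbsProb_flipLast]
  · simp only [pairField, Prod.map, cavField_flipLast]
    ring

/-- Replace the couplings to the last site by those of the second realisation. -/
def spliceCavity (x : (Fin N × Fin N → ℝ) × (Fin N × Fin N → ℝ)) (p : Fin N × Fin N) : ℝ :=
  if (p.2 : ℕ) < N - 1 then x.1 p else x.2 p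

/-- Splice all three components of the disorder. -/
def spliceDisorder (x : Disorder N × Disorder N) : Disorder N :=
  (spliceCavity (x.1.1, x.2.1), spliceCavity (x.1.2.1, x.2.2.1), spliceCavity (x.1.2.2, x.2.2.2))

lemma measurePreserving_spliceCavity :
    MeasurePreserving (spliceCavity (N := N)) ((gaussPi N).prod (gaussPi N)) (gaussPi N) := by
  refine measurePreserving_pi_combine (ι := Fin N × Fin N) (gaussianReal 0 1)
    (fun p x => if (p.2 : ℕ) < N - 1 then x.1 else x.2) fun p => ?_
  split_ifs
  · exact measurePreserving_fst
  · exact measurePreserving_snd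

lemma measurePreserving_spliceDisorder :
    MeasurePreserving (spliceDisorder (N := N)) ((disM3 N).prod (disM3 N)) (disM3 N) :=
  MeasurePreserving.prod_of_prod measurePreserving_spliceCavity
    (MeasurePreserving.prod_of_prod measurePreserving_spliceCavity measurePreserving_spliceCavity)

lemma couplingFst_spliceDisorder (x : Disorder N × Disorder N) :
    couplingFst t (spliceDisorder x) = spliceCavity (couplingFst t x.1, couplingFst t x.2) := by
  ext p
  simp only [couplingFst, spliceDisorder, spliceCavity]
  split_ifs <;> rfl

lemma couplingSnd_spliceDisorder (x : Disorder N × Disorder N) :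
    couplingSnd t (spliceDisorder x) = spliceCavity (couplingSnd t x.1, couplingSnd t x.2) := by
  ext p
  simp only [couplingSnd, spliceDisorder, spliceCavity]
  split_ifs <;> rfl

lemma hamCav_spliceCavity (x : (Fin N × Fin N → ℝ) × (Fin N × Fin N → ℝ)) (σ : Config N) :
    hamCav N β (spliceCavity x) σ = hamCav N β x.1 σ := by
  unfold hamCav
  congr 1
  refine Finset.sum_congr rfl fun p hp => ?_
  rw [spliceCavity, if_pos (Finset.mem_filter.1 hp).2.2]

lemma cavField_spliceCavity (x : (Fin N × Fin N → ℝ) × (Fin N × Fin N → ℝ)) (σ : Config N) :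
    cavField N β 1 (spliceCavity x) 0 σ = cavField N β 1 x.2 0 σ := by
  simp [cavField, spliceCavity]

lemma pairProb_spliceDisorder (x : Disorder N × Disorder N) (ρ : Config N × Config N) :
    pairProb N β t 0 (spliceDisorder x) ρ = pairProb N β t 0 x.1 ρ := by
  simp_rw [pairProb, couplingFst_spliceDisorder, couplingSnd_spliceDisorder, gibbsProb,
    hamTS_zero, hamCav_spliceCavity]

lemma pairField_spliceDisorder (x : Disorder N × Disorder N) (ρ : Config N × Config N) :
    pairField N β t (spliceDisorder x) ρ = pairField N β t x.2 ρ := by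
  simp_rw [pairField, couplingFst_spliceDisorder, couplingSnd_spliceDisorder,
    cavField_spliceCavity]

/-- Functions of the cavity disorder are independent of functions of the cavity field. -/
lemma integral_mul_of_spliceDisorder {F G : Disorder N → ℝ} (hF : Measurable F)
    (hG : Measurable G) (hFs : ∀ x, F (spliceDisorder x) = F x.1)
    (hGs : ∀ x, G (spliceDisorder x) = G x.2) :
    ∫ ω, F ω * G ω ∂disM3 N = (∫ ω, F ω ∂disM3 N) * ∫ ω, G ω ∂disM3 N := by
  have hFG : Measurable fun ω => F ω * G ω := hF.mul hG
  rw [← integral_comp_measurePreserving measurePreserving_spliceDisorder hFG,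
    ← integral_prod_mul]
  simp_rw [hFs, hGs]

lemma exp_sum_mul_eq_prod {ι : Type*} [Fintype ι] (a x : ι → ℝ) :
    Real.exp (∑ i, a i * x i) = ∏ i, Real.exp (a i * x i) :=
  Real.exp_sum _ _

lemma integrable_exp_linear_gaussian {ι : Type*} [Fintype ι] (a : ι → ℝ) :
    Integrable (fun x : ι → ℝ => Real.exp (∑ i, a i * x i))
      (Measure.pi fun _ : ι => gaussianReal 0 1) := by
  simp_rw [exp_sum_mul_eq_prod]
  exact Integrable.fintype_prod fun i => integrable_exp_mul_gaussianReal (a i)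

lemma integral_exp_linear_gaussian {ι : Type*} [Fintype ι] (a : ι → ℝ) :
    ∫ x : ι → ℝ, Real.exp (∑ i, a i * x i) ∂(Measure.pi fun _ : ι => gaussianReal 0 1) =
      Real.exp ((∑ i, a i ^ 2) / 2) := by
  have hmgf : ∀ i, ∫ y, Real.exp (a i * y) ∂gaussianReal 0 1 = Real.exp (a i ^ 2 / 2) := by
    intro i
    have := mgf_gaussianReal (p := gaussianReal 0 1) (X := id) (μ := 0) (v := 1)
      Measure.map_id (a i)
    simpa [mgf] using this
  simp_rw [exp_sum_mul_eq_prod]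
  rw [integral_fintype_prod_eq_prod (fun i y => Real.exp (a i * y)), Finset.sum_div, Real.exp_sum]
  exact Finset.prod_congr rfl fun i _ => hmgf i

/-- Twice the cavity field is a linear form in the couplings of squared length at most `4`. -/
lemma exists_two_mul_cavField_eq {n : ℕ} (hβ : β ∈ Set.Ioc (0 : ℝ) 1) (σ : Config (n + 1)) :
    ∃ a : Fin (n + 1) × Fin (n + 1) → ℝ,
      (∀ J, 2 * cavField (n + 1) β 1 J 0 σ = ∑ p, a p * J p) ∧ ∑ p, a p ^ 2 ≤ 4 := by
  set b : ℝ := β / √((n + 1 : ℕ) : ℝ) with hb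
  have hb2 : b ^ 2 * (n + 1) ≤ 1 := by
    rw [hb, div_pow, Real.sq_sqrt (Nat.cast_nonneg _)]
    push_cast
    rw [div_mul_cancel₀ _ (by positivity)]
    exact pow_le_one₀ hβ.1.le hβ.2
  refine ⟨fun p => if p.2 = Fin.last n then
    (if (p.1 : ℕ) < n then 2 * b * spin (σ (Fin.last n)) * spin (σ p.1) else 0) else 0,
    fun J => ?_, ?_⟩
  · rw [cavField_eq, Fintype.sum_prod_type, Finset.sum_filter]
    simp only [ite_mul, zero_mul, Finset.sum_ite_eq', Finset.mem_univ, if_true,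
      Finset.mul_sum]
    refine Finset.sum_congr rfl fun i _ => ?_
    split_ifs
    · ring
    · ring
  · have hterm : ∀ i : Fin (n + 1), (if (i : ℕ) < n then
        2 * b * spin (σ (Fin.last n)) * spin (σ i) else 0) ^ 2 ≤ 4 * b ^ 2 := fun i => by
      split_ifs
      · rw [mul_pow, mul_pow, sq (spin _), sq (spin _), spin_mul_self, spin_mul_self]
        linarith
      · rw [zero_pow two_ne_zero]
        positivity
    rw [Fintype.sum_prod_type]
    simp only [ite_pow, ne_eq, OfNat.ofNat_ne_zero, not_false_eq_true, zero_pow,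
      Finset.sum_ite_eq', Finset.mem_univ, if_true]
    simp only [ite_pow, ne_eq, OfNat.ofNat_ne_zero, not_false_eq_true, zero_pow] at hterm
    refine (Finset.sum_le_sum fun i _ => hterm i).trans ?_
    rw [Finset.sum_const, Finset.card_univ, Fintype.card_fin, nsmul_eq_mul]
    push_cast
    linarith

lemma integrable_exp_two_mul_cavField {n : ℕ} (hβ : β ∈ Set.Ioc (0 : ℝ) 1)
    (σ : Config (n + 1)) :
    Integrable (fun J => Real.exp (2 * cavField (n + 1) β 1 J 0 σ)) (gaussPi (n + 1)) := by
  obtain ⟨a, ha, -⟩ := exists_two_mul_cavField_eq hβ σ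
  simp_rw [ha]
  exact integrable_exp_linear_gaussian a

lemma integral_exp_two_mul_cavField_le {n : ℕ} (hβ : β ∈ Set.Ioc (0 : ℝ) 1)
    (σ : Config (n + 1)) :
    ∫ J, Real.exp (2 * cavField (n + 1) β 1 J 0 σ) ∂gaussPi (n + 1) ≤ Real.exp 2 := by
  obtain ⟨a, ha, ha4⟩ := exists_two_mul_cavField_eq hβ σ
  simp_rw [ha]
  rw [gaussPi, integral_exp_linear_gaussian a]
  exact Real.exp_le_exp.2 (by linarith)

lemma exp_pairField_le (ω : Disorder N) (ρ : Config N × Config N) :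
    Real.exp (pairField N β t ω ρ) ≤
      (Real.exp (2 * cavField N β 1 (couplingFst t ω) 0 ρ.1) +
        Real.exp (2 * cavField N β 1 (couplingSnd t ω) 0 ρ.2)) / 2 := by
  rw [pairField, Real.exp_add, two_mul, two_mul, Real.exp_add, Real.exp_add]
  nlinarith [sq_nonneg (Real.exp (cavField N β 1 (couplingFst t ω) 0 ρ.1) -
    Real.exp (cavField N β 1 (couplingSnd t ω) 0 ρ.2))]

lemma exp_pairField_moment {n : ℕ} (hβ : β ∈ Set.Ioc (0 : ℝ) 1) (ht : t ∈ Set.Icc (0 : ℝ) 1)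
    (ρ : Config (n + 1) × Config (n + 1)) :
    Integrable (fun ω => Real.exp (pairField (n + 1) β t ω ρ)) (disM3 (n + 1)) ∧
      ∫ ω, Real.exp (pairField (n + 1) β t ω ρ) ∂disM3 (n + 1) ≤ Real.exp 2 := by
  have hmeas : ∀ σ : Config (n + 1), Measurable
      fun J => Real.exp (2 * cavField (n + 1) β 1 J 0 σ) := fun σ =>
    ((measurable_cavField σ).const_mul 2).exp
  have int_fst := (measurePreserving_couplingFst ht).integrable_comp_of_integrable
    (integrable_exp_two_mul_cavField hβ ρ.1)
  have int_snd := (measurePreserving_couplingSnd ht).integrable_comp_of_integrable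
    (integrable_exp_two_mul_cavField hβ ρ.2)
  have hint : Integrable (fun ω => Real.exp (pairField (n + 1) β t ω ρ)) (disM3 (n + 1)) :=
    ((int_fst.add int_snd).div_const 2).mono' (by fun_prop) (ae_of_all _ fun ω => by
      rw [Real.norm_eq_abs, Real.abs_exp]
      exact exp_pairField_le ω ρ)
  refine ⟨hint, (integral_mono hint ((int_fst.add int_snd).div_const 2)
    fun ω => exp_pairField_le ω ρ).trans ?_⟩
  rw [integral_div, integral_add' int_fst int_snd]
  simp_rw [Function.comp_def]
  rw [integral_comp_measurePreserving (measurePreserving_couplingFst ht) (hmeas ρ.1),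
    integral_comp_measurePreserving (measurePreserving_couplingSnd ht) (hmeas ρ.2)]
  linarith [integral_exp_two_mul_cavField_le hβ ρ.1, integral_exp_two_mul_cavField_le hβ ρ.2]

/-- Removing the cavity field costs at most a constant factor. -/
lemma EgibbsTS1_zero_le_one {n : ℕ} (hβ : β ∈ Set.Ioc (0 : ℝ) 1) (ht : t ∈ Set.Icc (0 : ℝ) 1)
    {f : Config (n + 1) × Config (n + 1) → ℝ} (hf : ∀ ρ, 0 ≤ f ρ)
    (hflip : ∀ σ τ, f (flipLast σ, flipLast τ) = f (σ, τ)) :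
    EgibbsTS1 (n + 1) β t 0 f ≤ Real.exp 2 * EgibbsTS1 (n + 1) β t 1 f := by
  simp_rw [EgibbsTS1, gibbsTS1_eq_sum]
  set F₀ : Disorder (n + 1) → ℝ := fun ω => ∑ ρ, f ρ * pairProb (n + 1) β t 0 ω ρ with hF₀
  set F₁ : Disorder (n + 1) → ℝ := fun ω => ∑ ρ, f ρ * pairProb (n + 1) β t 1 ω ρ with hF₁
  set D : Disorder (n + 1) → ℝ := fun ω =>
    ∑ ρ, pairProb (n + 1) β t 0 ω ρ * Real.exp (pairField (n + 1) β t ω ρ) with hD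
  have int₀ : Integrable F₀ (disM3 (n + 1)) :=
    integrable_finsetSum _ fun ρ _ => (integrable_pairProb ρ).const_mul _
  have int₁ : Integrable F₁ (disM3 (n + 1)) :=
    integrable_finsetSum _ fun ρ _ => (integrable_pairProb ρ).const_mul _
  have meas₀ : Measurable F₀ := by fun_prop
  have F₀_nonneg : ∀ ω, 0 ≤ F₀ ω := fun ω =>
    Finset.sum_nonneg fun ρ _ => mul_nonneg (hf ρ) (pairProb_nonneg ω ρ)
  have F₀_le : ∀ ω, F₀ ω ≤ ∑ ρ, f ρ := fun ω => Finset.sum_le_sum fun ρ _ =>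
    mul_le_of_le_one_right (hf ρ) (pairProb_le_one ω ρ)
  have hdom : ∀ ω, F₀ ω ≤ F₁ ω * D ω := fun ω => sum_pairProb_zero_le ω hf hflip
  have D_pos : ∀ ω, 0 < D ω := fun ω => by
    refine lt_of_lt_of_le one_pos ?_
    have := sum_pairProb_zero_le (β := β) (t := t) ω (f := fun _ => 1)
      (fun _ => zero_le_one) (fun _ _ => rfl)
    simpa only [one_mul, sum_pairProb] using this
  have term_bound : ∀ ρ ω, |F₀ ω * pairProb (n + 1) β t 0 ω ρ| ≤ ∑ ρ, f ρ := fun ρ ω => by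
    rw [abs_of_nonneg (mul_nonneg (F₀_nonneg ω) (pairProb_nonneg ω ρ))]
    exact (mul_le_of_le_one_right (F₀_nonneg ω) (pairProb_le_one ω ρ)).trans (F₀_le ω)
  have int_term : ∀ ρ, Integrable (fun ω => F₀ ω * pairProb (n + 1) β t 0 ω ρ)
      (disM3 (n + 1)) := fun ρ =>
    Integrable.of_measurable_of_abs_le (by fun_prop) (term_bound ρ)
  have int_exp : ∀ ρ, Integrable (fun ω => F₀ ω * pairProb (n + 1) β t 0 ω ρ *
      Real.exp (pairField (n + 1) β t ω ρ)) (disM3 (n + 1)) := fun ρ =>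
    (exp_pairField_moment hβ ht ρ).1.bdd_mul (by fun_prop) (ae_of_all _ (term_bound ρ))
  have FD_eq : ∀ ω, F₀ ω * D ω = ∑ ρ, F₀ ω * pairProb (n + 1) β t 0 ω ρ *
      Real.exp (pairField (n + 1) β t ω ρ) := fun ω => by
    simp_rw [hD, Finset.mul_sum, mul_assoc]
  have int_FD : Integrable (fun ω => F₀ ω * D ω) (disM3 (n + 1)) := by
    simp_rw [FD_eq]
    exact integrable_finsetSum _ fun ρ _ => int_exp ρ
  have FD_le : ∫ ω, F₀ ω * D ω ∂disM3 (n + 1) ≤ Real.exp 2 * ∫ ω, F₀ ω ∂disM3 (n + 1) := by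
    calc ∫ ω, F₀ ω * D ω ∂disM3 (n + 1)
        = ∑ ρ, (∫ ω, F₀ ω * pairProb (n + 1) β t 0 ω ρ ∂disM3 (n + 1)) *
            ∫ ω, Real.exp (pairField (n + 1) β t ω ρ) ∂disM3 (n + 1) := by
          simp_rw [FD_eq]
          rw [integral_finsetSum _ fun ρ _ => int_exp ρ]
          refine Finset.sum_congr rfl fun ρ _ => integral_mul_of_spliceDisorder
            (by fun_prop) (by fun_prop) (fun x => ?_) (fun x => ?_)
          · simp_rw [hF₀, pairProb_spliceDisorder]
          · rw [pairField_spliceDisorder]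
      _ ≤ ∑ ρ, (∫ ω, F₀ ω * pairProb (n + 1) β t 0 ω ρ ∂disM3 (n + 1)) * Real.exp 2 :=
          Finset.sum_le_sum fun ρ _ => mul_le_mul_of_nonneg_left (exp_pairField_moment hβ ht ρ).2
            (integral_nonneg fun ω => mul_nonneg (F₀_nonneg ω) (pairProb_nonneg ω ρ))
      _ = Real.exp 2 * ∫ ω, F₀ ω ∂disM3 (n + 1) := by
          rw [← Finset.sum_mul, ← integral_finsetSum _ fun ρ _ => int_term ρ]
          simp_rw [← Finset.mul_sum, sum_pairProb, mul_one]
          ring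
  have hpoint : ∀ ω, 2 * Real.exp 2 * F₀ ω ≤ Real.exp 2 ^ 2 * F₁ ω + F₀ ω * D ω := fun ω => by
    refine le_of_mul_le_mul_right ?_ (D_pos ω)
    nlinarith [mul_le_mul_of_nonneg_left (hdom ω) (sq_nonneg (Real.exp 2)),
      mul_nonneg (F₀_nonneg ω) (sq_nonneg (Real.exp 2 - D ω))]
  have hmono := integral_mono (int₀.const_mul (2 * Real.exp 2))
    ((int₁.const_mul (Real.exp 2 ^ 2)).add int_FD) hpoint
  simp_rw [Pi.add_apply] at hmono
  rw [integral_add (int₁.const_mul _) int_FD, integral_const_mul, integral_const_mul] at hmono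
  refine le_of_mul_le_mul_left ?_ (Real.exp_pos 2)
  nlinarith

end CavityComparison

section ThirdOrder

variable {N : ℕ} {β s t : ℝ}

lemma ham_eq_hamTS {n : ℕ} (J : Fin (n + 1) × Fin (n + 1) → ℝ) (σ : Config (n + 1)) :
    ham (n + 1) β J σ = hamTS (n + 1) β 1 1 J 0 σ := by
  have hlast : ∑ p ∈ Finset.univ.filter
        (fun p : Fin (n + 1) × Fin (n + 1) => p.1 < p.2 ∧ ¬(p.2 : ℕ) < n),
        J p * spin (σ p.1) * spin (σ p.2) =
      ∑ i ∈ Finset.univ.filter (fun i : Fin (n + 1) => (i : ℕ) < n),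
        J (i, Fin.last n) * spin (σ i) * spin (σ (Fin.last n)) := by
    have eq_last : ∀ j : Fin (n + 1), ¬(j : ℕ) < n → j = Fin.last n := fun j hj =>
      Fin.ext (by simp only [Fin.val_last]; omega)
    refine Finset.sum_nbij' Prod.fst (fun i => (i, Fin.last n)) ?_ ?_ ?_ ?_ ?_
    · rintro ⟨i, j⟩ hp
      obtain ⟨hij, hj⟩ := (Finset.mem_filter.1 hp).2
      obtain rfl := eq_last j hj
      exact Finset.mem_filter.2 ⟨Finset.mem_univ _, hij⟩
    · intro i hi
      exact Finset.mem_filter.2 ⟨Finset.mem_univ _, (Finset.mem_filter.1 hi).2, lt_irrefl n⟩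
    · rintro ⟨i, j⟩ hp
      rw [eq_last j (Finset.mem_filter.1 hp).2.2]
    · intro i _
      rfl
    · rintro ⟨i, j⟩ hp
      rw [eq_last j (Finset.mem_filter.1 hp).2.2]
  rw [hamTS_one, cavField_eq, ham, hamCav, mul_assoc (_ / _), ← mul_add]
  congr 1
  rw [← Finset.sum_filter_add_sum_filter_not _
    (fun p : Fin (n + 1) × Fin (n + 1) => (p.2 : ℕ) < n), Finset.filter_filter,
    Finset.filter_filter, hlast, Finset.mul_sum]
  congr 1
  exact Finset.sum_congr rfl fun i _ => by ring

lemma Egibbs2_eq_EgibbsTS1 {n : ℕ} (f : Config (n + 1) → Config (n + 1) → ℝ) :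
    Egibbs2 (n + 1) β f = EgibbsTS1 (n + 1) β 1 1 (fun ρ => f ρ.1 ρ.2) := by
  rw [EgibbsTS1_one_eq_integral, Egibbs2]
  congr with g
  simp_rw [gibbs2, partFun, ham_eq_hamTS, gibbsProb, Fintype.sum_prod_type, Finset.sum_div,
    Real.exp_add]
  refine Finset.sum_congr rfl fun σ _ => Finset.sum_congr rfl fun τ _ => ?_
  rw [mul_div_assoc, sq, mul_div_mul_comm]

lemma sum_fst_mul_pairProb (ω : Disorder N) (h : Config N → ℝ) :
    ∑ ρ, h ρ.1 * pairProb N β t s ω ρ = ∑ σ, h σ * gibbsProb N β s (couplingFst t ω) σ := by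
  simp_rw [pairProb, Fintype.sum_prod_type, ← mul_assoc, ← Finset.mul_sum, sum_gibbsProb, mul_one]

lemma sum_snd_mul_pairProb (ω : Disorder N) (h : Config N → ℝ) :
    ∑ ρ, h ρ.2 * pairProb N β t s ω ρ = ∑ τ, h τ * gibbsProb N β s (couplingSnd t ω) τ := by
  simp_rw [pairProb, Fintype.sum_prod_type_right, mul_left_comm (h _), ← Finset.sum_mul,
    sum_gibbsProb, one_mul]

lemma gibbsTS2_eq_sum_sum (ω : Disorder N)
    (f : Config N × Config N → Config N × Config N → ℝ) :
    gibbsTS2 N β t s ω.1 ω.2.1 ω.2.2 f =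
      ∑ ρ₁, (∑ ρ₂, f ρ₁ ρ₂ * pairProb N β t s ω ρ₂) * pairProb N β t s ω ρ₁ := by
  rw [gibbsTS2_eq_sum]
  refine Finset.sum_congr rfl fun ρ₁ _ => ?_
  rw [Finset.sum_mul]
  exact Finset.sum_congr rfl fun ρ₂ _ => by ring

lemma EgibbsTS2_fst_pair (f : Config N × Config N → ℝ) :
    EgibbsTS2 N β t s (fun ρ₁ _ => f ρ₁) = EgibbsTS1 N β t s f := by
  simp_rw [EgibbsTS2, EgibbsTS1, gibbsTS2_eq_sum_sum, gibbsTS1_eq_sum, ← Finset.mul_sum,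
    sum_pairProb, mul_one]

lemma EgibbsTS2_crossed_pair (f : Config N → Config N → ℝ) :
    EgibbsTS2 N β t s (fun ρ₁ ρ₂ => f ρ₂.1 ρ₁.2) =
      EgibbsTS1 N β t s (fun ρ => f ρ.1 ρ.2) := by
  rw [EgibbsTS2, EgibbsTS1]
  congr with ω
  rw [gibbsTS2_eq_sum_sum, gibbsTS1_eq_sum]
  have inner (τ : Config N) := sum_fst_mul_pairProb (β := β) (s := s) (t := t) ω (fun σ => f σ τ)
  simp_rw [inner]
  rw [sum_snd_mul_pairProb ω
    (fun τ => ∑ σ, f σ τ * gibbsProb N β s (couplingFst t ω) σ)]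
  simp_rw [Fintype.sum_prod_type_right, pairProb, Finset.sum_mul, mul_assoc]

lemma EgibbsTS2_fst_fst (ht : t ∈ Set.Icc (0 : ℝ) 1) (f : Config N → Config N → ℝ) :
    EgibbsTS2 N β t s (fun ρ₁ ρ₂ => f ρ₁.1 ρ₂.1) =
      EgibbsTS1 N β 1 s (fun ρ => f ρ.1 ρ.2) := by
  rw [EgibbsTS1_one_eq_integral,
    ← integral_comp_measurePreserving (measurePreserving_couplingFst ht) (by fun_prop), EgibbsTS2]
  congr with ω
  rw [gibbsTS2_eq_sum_sum]
  simp_rw [sum_fst_mul_pairProb ω (f _)]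
  rw [sum_fst_mul_pairProb ω
    (fun σ => ∑ σ', f σ σ' * gibbsProb N β s (couplingFst t ω) σ')]
  simp_rw [Fintype.sum_prod_type, Finset.sum_mul]
  exact Finset.sum_congr rfl fun σ _ => Finset.sum_congr rfl fun σ' _ => by ring

/-- The third-order average is `N⁻³ Tr(C₁C₂C₁)` for the positive semidefinite spin correlation
matrices `C₁, C₂` of the two systems. -/
lemma gibbsTS2_third_order_nonneg (ω : Disorder N) :
    0 ≤ gibbsTS2 N β t s ω.1 ω.2.1 ω.2.2 (fun ρ₁ ρ₂ =>
      ovlpm N ρ₁.1 ρ₁.2 * ovlpm N ρ₂.1 ρ₁.2 * ovlpm N ρ₁.1 ρ₂.1) := by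
  set p := gibbsProb N β s (couplingFst t ω)
  set q := gibbsProb N β s (couplingSnd t ω)
  set S := Finset.univ.filter (fun i : Fin N => (i : ℕ) < N - 1)
  have key : gibbsTS2 N β t s ω.1 ω.2.1 ω.2.2 (fun ρ₁ ρ₂ =>
      ovlpm N ρ₁.1 ρ₁.2 * ovlpm N ρ₂.1 ρ₁.2 * ovlpm N ρ₁.1 ρ₂.1) =
      ∑ τ, (∑ k ∈ S, (∑ σ, ovlpm N σ τ * spin (σ k) * p σ) ^ 2) / N * q τ := by
    rw [gibbsTS2_eq_sum_sum]
    have inner (σ τ : Config N) := sum_fst_mul_pairProb (β := β) (s := s) (t := t) ω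
      (fun σ' => ovlpm N σ τ * ovlpm N σ' τ * ovlpm N σ σ')
    simp_rw [inner]
    rw [Fintype.sum_prod_type_right]
    refine Finset.sum_congr rfl fun τ _ => ?_
    simp_rw [pairProb, ← mul_assoc]
    rw [← Finset.sum_mul]
    congr 1
    simp_rw [sq, Finset.sum_mul_sum, Finset.sum_div, Finset.sum_mul]
    rw [Finset.sum_comm (s := S)]
    refine Finset.sum_congr rfl fun σ _ => ?_
    rw [Finset.sum_comm (s := S)]
    refine Finset.sum_congr rfl fun σ' _ => ?_
    rw [show ovlpm N σ σ' = (∑ k ∈ S, spin (σ k) * spin (σ' k)) / N from rfl, Finset.sum_div,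
      Finset.mul_sum, Finset.sum_mul, Finset.sum_mul]
    exact Finset.sum_congr rfl fun k _ => by ring
  rw [key]
  exact Finset.sum_nonneg fun τ _ => mul_nonneg
    (div_nonneg (Finset.sum_nonneg fun k _ => sq_nonneg _) (Nat.cast_nonneg N))
    (gibbsProb_nonneg _ τ)

lemma EgibbsTS2_mono {f h : Config N × Config N → Config N × Config N → ℝ}
    (hfh : ∀ ρ₁ ρ₂, f ρ₁ ρ₂ ≤ h ρ₁ ρ₂) : EgibbsTS2 N β t s f ≤ EgibbsTS2 N β t s h := by
  simp_rw [EgibbsTS2_eq_sum]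
  exact Finset.sum_le_sum fun ρ₁ _ => Finset.sum_le_sum fun ρ₂ _ =>
    mul_le_mul_of_nonneg_right (hfh ρ₁ ρ₂)
      (integral_nonneg fun ω => mul_nonneg (pairProb_nonneg ω ρ₁) (pairProb_nonneg ω ρ₂))

lemma EgibbsTS2_half_add (f h : Config N × Config N → Config N × Config N → ℝ) :
    EgibbsTS2 N β t s (fun ρ₁ ρ₂ => (f ρ₁ ρ₂ + h ρ₁ ρ₂) / 2) =
      (EgibbsTS2 N β t s f + EgibbsTS2 N β t s h) / 2 := by
  simp_rw [EgibbsTS2_eq_sum, ← Finset.sum_add_distrib, Finset.sum_div]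
  exact Finset.sum_congr rfl fun ρ₁ _ => Finset.sum_congr rfl fun ρ₂ _ => by ring

lemma EgibbsTS2_mul_le_sqrt_mul_sqrt
    (f h : Config N × Config N → Config N × Config N → ℝ) :
    EgibbsTS2 N β t s (fun ρ₁ ρ₂ => f ρ₁ ρ₂ * h ρ₁ ρ₂) ≤
      √(EgibbsTS2 N β t s (fun ρ₁ ρ₂ => f ρ₁ ρ₂ ^ 2)) *
        √(EgibbsTS2 N β t s (fun ρ₁ ρ₂ => h ρ₁ ρ₂ ^ 2)) := by
  simp_rw [EgibbsTS2_eq_sum]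
  set M : Config N × Config N → Config N × Config N → ℝ := fun ρ₁ ρ₂ =>
    ∫ ω, pairProb N β t s ω ρ₁ * pairProb N β t s ω ρ₂ ∂disM3 N
  have hM : ∀ ρ₁ ρ₂, √(M ρ₁ ρ₂) * √(M ρ₁ ρ₂) = M ρ₁ ρ₂ := fun ρ₁ ρ₂ =>
    Real.mul_self_sqrt
      (integral_nonneg fun ω => mul_nonneg (pairProb_nonneg ω ρ₁) (pairProb_nonneg ω ρ₂))
  have hcs := Real.sum_mul_le_sqrt_mul_sqrt Finset.univ
    (fun x : (Config N × Config N) × (Config N × Config N) => f x.1 x.2 * √(M x.1 x.2))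
    (fun x => h x.1 x.2 * √(M x.1 x.2))
  simp only [mul_mul_mul_comm, mul_pow, sq (√_), hM] at hcs
  simpa only [Fintype.sum_prod_type (f := fun x : (Config N × Config N) × (Config N × Config N) =>
    _)] using hcs

end ThirdOrder

/-- sign and Cauchy–Schwarz bound for the decoupled third-order overlap
term `E⟨R⁻(σ¹,τ¹)R⁻(σ²,τ¹)R⁻(σ¹,σ²)⟩_{t,0}`. -/
theorem sk_third_order_overlap_bound :
    ∃ K : ℝ, 0 < K ∧ ∀ N : ℕ, 1 ≤ N → ∀ β ∈ Set.Ioc (0 : ℝ) 1, ∀ t ∈ Set.Icc (0 : ℝ) 1,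
      0 ≤ EgibbsTS2 N β t 0 (fun ρ₁ ρ₂ =>
          ovlpm N ρ₁.1 ρ₁.2 * ovlpm N ρ₂.1 ρ₁.2 * ovlpm N ρ₁.1 ρ₂.1) ∧
        EgibbsTS2 N β t 0 (fun ρ₁ ρ₂ =>
            ovlpm N ρ₁.1 ρ₁.2 * ovlpm N ρ₂.1 ρ₁.2 * ovlpm N ρ₁.1 ρ₂.1) ≤
          K * Real.sqrt (EgibbsTS1 N β t 1 (fun ρ => ovlp N ρ.1 ρ.2 ^ 2)) *
            Real.sqrt (Egibbs2 N β (fun σ τ => ovlp N σ τ ^ 4)) := by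
  refine ⟨Real.exp 2, Real.exp_pos 2, fun N hN β hβ t ht => ⟨integral_nonneg fun ω =>
    gibbsTS2_third_order_nonneg ω, ?_⟩⟩
  obtain ⟨n, rfl⟩ : ∃ n, N = n + 1 := ⟨N - 1, by omega⟩
  have second_moment : EgibbsTS1 (n + 1) β t 0 (fun ρ => ovlpm (n + 1) ρ.1 ρ.2 ^ 2) ≤
      Real.exp 2 * EgibbsTS1 (n + 1) β t 1 (fun ρ => ovlp (n + 1) ρ.1 ρ.2 ^ 2) :=
    (EgibbsTS1_zero_le_one hβ ht (fun _ => by positivity)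
      fun σ τ => by simp only [ovlpm_flipLast]).trans
      (mul_le_mul_of_nonneg_left (EgibbsTS1_ovlpm_pow_le_ovlp_pow 2) (Real.exp_pos 2).le)
  have fourth_moment : EgibbsTS1 (n + 1) β 1 0 (fun ρ => ovlpm (n + 1) ρ.1 ρ.2 ^ 4) ≤
      Real.exp 2 * Egibbs2 (n + 1) β (fun σ τ => ovlp (n + 1) σ τ ^ 4) := by
    rw [Egibbs2_eq_EgibbsTS1]
    exact (EgibbsTS1_zero_le_one hβ ⟨zero_le_one, le_rfl⟩ (fun _ => by positivity)
      fun σ τ => by simp only [ovlpm_flipLast]).trans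
      (mul_le_mul_of_nonneg_left (EgibbsTS1_ovlpm_pow_le_ovlp_pow 4) (Real.exp_pos 2).le)
  have mixed_moment : EgibbsTS2 (n + 1) β t 0 (fun ρ₁ ρ₂ =>
      (ovlpm (n + 1) ρ₂.1 ρ₁.2 * ovlpm (n + 1) ρ₁.1 ρ₂.1) ^ 2) ≤
      EgibbsTS1 (n + 1) β 1 0 (fun ρ => ovlpm (n + 1) ρ.1 ρ.2 ^ 4) := by
    have hmono := EgibbsTS2_mono (N := n + 1) (β := β) (t := t) (s := 0)
      (f := fun ρ₁ ρ₂ => (ovlpm (n + 1) ρ₂.1 ρ₁.2 * ovlpm (n + 1) ρ₁.1 ρ₂.1) ^ 2)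
      (h := fun ρ₁ ρ₂ => (ovlpm (n + 1) ρ₂.1 ρ₁.2 ^ 4 + ovlpm (n + 1) ρ₁.1 ρ₂.1 ^ 4) / 2)
      fun ρ₁ ρ₂ => by
        nlinarith [sq_nonneg (ovlpm (n + 1) ρ₂.1 ρ₁.2 ^ 2 - ovlpm (n + 1) ρ₁.1 ρ₂.1 ^ 2)]
    rw [EgibbsTS2_half_add (fun ρ₁ ρ₂ => ovlpm (n + 1) ρ₂.1 ρ₁.2 ^ 4)
      (fun ρ₁ ρ₂ => ovlpm (n + 1) ρ₁.1 ρ₂.1 ^ 4),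
      EgibbsTS2_crossed_pair (fun σ τ => ovlpm (n + 1) σ τ ^ 4),
      EgibbsTS2_fst_fst ht (fun σ τ => ovlpm (n + 1) σ τ ^ 4)] at hmono
    linarith [EgibbsTS1_ovlpm_pow_le_one (N := n + 1) (β := β) (s := 0) ht 4]
  have cauchy_schwarz := EgibbsTS2_mul_le_sqrt_mul_sqrt (N := n + 1) (β := β) (t := t) (s := 0)
    (fun ρ₁ _ => ovlpm (n + 1) ρ₁.1 ρ₁.2)
    (fun ρ₁ ρ₂ => ovlpm (n + 1) ρ₂.1 ρ₁.2 * ovlpm (n + 1) ρ₁.1 ρ₂.1)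
  rw [EgibbsTS2_fst_pair (fun ρ => ovlpm (n + 1) ρ.1 ρ.2 ^ 2)] at cauchy_schwarz
  simp_rw [← mul_assoc] at cauchy_schwarz
  refine cauchy_schwarz.trans ((mul_le_mul (Real.sqrt_le_sqrt second_moment)
    (Real.sqrt_le_sqrt (mixed_moment.trans fourth_moment)) (Real.sqrt_nonneg _)
    (Real.sqrt_nonneg _)).trans_eq ?_)
  rw [Real.sqrt_mul (Real.exp_pos 2).le, Real.sqrt_mul (Real.exp_pos 2).le, mul_mul_mul_comm,
    Real.mul_self_sqrt (Real.exp_pos 2).le, mul_assoc]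

end
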